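/- Let r ≥ 1 be an integer and α, β > −1 real. For each n ≥ 1 let μ_n = (1/n) ∑_{j=1}^{n} δ_{x_{j,n}} be the normalized counting measure of the zeros x_{1,n}, …, x_{n,n} ∈ (0,1) of p_n(x; α, β). Suppose (n_k)_k is a strictly increasing sequence of positive integers such that μ_{n_k} converges weakly to a probability measure μ on [0,1]. Then the Stieltjes transform S(z) = ∫_0^1 dμ(x)/(z−x) satisfies, for every z ∈ ℂ ∖ [0,1], the algebraic equation z(1−z^r) S(z)^{r+1} + ∑_{ℓ=0}^{r−1} (−1)^{r+ℓ+1} C(r+1,ℓ)(r−ℓ) z^ℓ S(z)^ℓ = 0; equivalently, z S(z)^{r+1} = (z S(z) + r)(z S(z) − 1)^r. -/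

import Mathlib

/-- The polynomial p_n(x; α, β) on the r-star. -/
noncomputable def jacAng (r n : ℕ) (α β x : ℝ) : ℝ :=
  ∑ k ∈ Finset.range (n + 1), (n.choose k : ℝ) *
    (Real.Gamma (n + α + (β + k) / r + 1) /
      (Real.Gamma (n + α + 1) * Real.Gamma ((β + k) / r + 1))) *
    (-1) ^ (n - k) * x ^ k

open Polynomial in
/-- The first-order operator `θ + c`, where `θ = X d/dX` is the Euler operator. -/
noncomputable def eulerShift (c : ℂ) (Q : ℂ[X]) : ℂ[X] :=
  X * derivative Q + C c * Q

open Polynomial in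
/-- The product `(θ + c (s - 1)) ⋯ (θ + c 0)` of shifted Euler operators. -/
noncomputable def eulerShiftProd (c : ℕ → ℂ) (Q : ℂ[X]) : ℕ → ℂ[X]
  | 0 => Q
  | s + 1 => eulerShift (c s) (eulerShiftProd c Q s)

open Polynomial in
lemma coeff_eulerShift (c : ℂ) (Q : ℂ[X]) (m : ℕ) :
    (eulerShift c Q).coeff m = (m + c) * Q.coeff m := by
  cases m with
  | zero => simp [eulerShift]
  | succ m =>
    simp only [eulerShift, coeff_add, coeff_X_mul, coeff_derivative, coeff_C_mul]
    push_cast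
    ring

open Polynomial in
lemma coeff_eulerShiftProd (c : ℕ → ℂ) (Q : ℂ[X]) (s m : ℕ) :
    (eulerShiftProd c Q s).coeff m = (∏ i ∈ Finset.range s, (m + c i)) * Q.coeff m := by
  induction s with
  | zero => simp [eulerShiftProd]
  | succ s ih => rw [eulerShiftProd, coeff_eulerShift, ih, Finset.prod_range_succ]; ring

/-- A sequence of functions that is uniformly bounded near every point of `U`. -/
def LocallyUnifBounded (U : Set ℂ) (f : ℕ → ℂ → ℂ) : Prop :=
  ∀ z ∈ U, ∃ M, ∀ᶠ y in nhds z, ∀ k, ‖f k y‖ ≤ M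

lemma LocallyUnifBounded.deriv {U : Set ℂ} (hU : IsOpen U) {f : ℕ → ℂ → ℂ}
    (hd : ∀ k, DifferentiableOn ℂ (f k) U) (hf : LocallyUnifBounded U f) :
    LocallyUnifBounded U (fun k => _root_.deriv (f k)) := by
  intro z hz
  obtain ⟨M, hM⟩ := hf z hz
  obtain ⟨ε, hε, hball⟩ := Metric.eventually_nhds_iff_ball.1 (hM.and (hU.mem_nhds hz))
  refine ⟨M / (ε / 4), ?_⟩
  filter_upwards [Metric.ball_mem_nhds z (half_pos hε)] with y hy k
  have hsub : Metric.closedBall y (ε / 4) ⊆ Metric.ball z ε := by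
    intro v hv
    rw [Metric.mem_closedBall] at hv
    rw [Metric.mem_ball] at hy ⊢
    linarith [dist_triangle v y z]
  refine Complex.norm_deriv_le_of_forall_mem_sphere_norm_le (by positivity) ?_ ?_
  · refine DifferentiableOn.diffContOnCl_ball (U := Metric.closedBall y (ε / 4)) ?_ subset_rfl
    exact (hd k).mono fun v hv => (hball v (hsub hv)).2
  · exact fun v hv => (hball v (hsub (Metric.sphere_subset_closedBall hv))).1 k

section EulerAsymptotics

open Polynomial Filter Topology

variable {U : Set ℂ} {P : ℕ → ℂ[X]} {N : ℕ → ℂ}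

lemma eval_eulerShift_div {P Q : ℂ[X]} {N : ℂ} (hN : N ≠ 0)
    (hP : ∀ y ∈ U, P.eval y ≠ 0) (c : ℂ) (m : ℕ) {y : ℂ} (hy : y ∈ U) :
    (eulerShift c Q).eval y / (N ^ (m + 1) * P.eval y) =
      (y * P.derivative.eval y / (N * P.eval y) + c / N) * (Q.eval y / (N ^ m * P.eval y)) +
        N⁻¹ * (y * deriv (fun v => Q.eval v / (N ^ m * P.eval v)) y) := by
  have hPy := hP y hy
  have hd : HasDerivAt (fun v => Q.eval v / (N ^ m * P.eval v)) _ y :=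
    (Q.hasDerivAt y).div ((P.hasDerivAt y).const_mul (N ^ m))
      (mul_ne_zero (pow_ne_zero _ hN) hPy)
  rw [hd.deriv]
  simp only [eulerShift, eval_add, eval_mul, eval_X, eval_C]
  field_simp
  ring

lemma eulerShift_asymptotics (hU : IsOpen U) (hN : ∀ k, N k ≠ 0)
    (hNlim : Tendsto (fun k => (N k)⁻¹) atTop (𝓝 0)) (hP : ∀ k, ∀ y ∈ U, (P k).eval y ≠ 0)
    (hw : LocallyUnifBounded U fun k y => y * (P k).derivative.eval y / (N k * (P k).eval y))
    {z ω : ℂ} (hz : z ∈ U)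
    (hω : Tendsto (fun k => z * (P k).derivative.eval z / (N k * (P k).eval z)) atTop (𝓝 ω))
    {Q : ℕ → ℂ[X]} {m : ℕ} {g : ℂ}
    (hQ : LocallyUnifBounded U fun k y => (Q k).eval y / (N k ^ m * (P k).eval y))
    (hg : Tendsto (fun k => (Q k).eval z / (N k ^ m * (P k).eval z)) atTop (𝓝 g))
    {c : ℕ → ℂ} {a : ℂ} (hc : Tendsto (fun k => c k / N k) atTop (𝓝 a)) :
    (LocallyUnifBounded U fun k y =>
        (eulerShift (c k) (Q k)).eval y / (N k ^ (m + 1) * (P k).eval y)) ∧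
      Tendsto (fun k => (eulerShift (c k) (Q k)).eval z / (N k ^ (m + 1) * (P k).eval z))
        atTop (𝓝 ((ω + a) * g)) := by
  have hdiff : ∀ k, DifferentiableOn ℂ (fun y => (Q k).eval y / (N k ^ m * (P k).eval y)) U :=
    fun k => (Q k).differentiable.differentiableOn.div
      ((P k).differentiable.differentiableOn.const_mul _)
      fun y hy => mul_ne_zero (pow_ne_zero _ (hN k)) (hP k y hy)
  have hQ' := hQ.deriv hU hdiff
  obtain ⟨A, hA⟩ := hc.norm.bddAbove_range
  obtain ⟨B, hB⟩ := hNlim.norm.bddAbove_range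
  have hA' : ∀ k, ‖c k / N k‖ ≤ A := fun k => hA ⟨k, rfl⟩
  have hB' : ∀ k, ‖(N k)⁻¹‖ ≤ B := fun k => hB ⟨k, rfl⟩
  constructor
  · intro v hv
    obtain ⟨M₁, h₁⟩ := hw v hv
    obtain ⟨M₂, h₂⟩ := hQ v hv
    obtain ⟨M₃, h₃⟩ := hQ' v hv
    refine ⟨(M₁ + A) * M₂ + B * ((‖v‖ + 1) * M₃), ?_⟩
    filter_upwards [h₁, h₂, h₃, hU.mem_nhds hv, Metric.ball_mem_nhds v one_pos]
      with y h₁ h₂ h₃ hy hyv k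
    rw [eval_eulerShift_div (hN k) (hP k) (c k) m hy]
    have hyn : ‖y‖ ≤ ‖v‖ + 1 := by
      have := norm_sub_norm_le y v
      rw [mem_ball_iff_norm] at hyv
      linarith
    have hM₁ := (norm_nonneg _).trans (h₁ k)
    have hA0 := (norm_nonneg _).trans (hA' k)
    have hB0 := (norm_nonneg _).trans (hB' k)
    refine (norm_add_le _ _).trans (add_le_add ?_ ?_)
    · rw [norm_mul]
      exact mul_le_mul ((norm_add_le _ _).trans (add_le_add (h₁ k) (hA' k))) (h₂ k)
        (norm_nonneg _) (by positivity)
    · rw [norm_mul, norm_mul]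
      exact mul_le_mul (hB' k) (mul_le_mul hyn (h₃ k) (norm_nonneg _) (by positivity))
        (by positivity) hB0
  · obtain ⟨M₃, h₃⟩ := hQ' z hz
    have hsmall : Tendsto (fun k => (N k)⁻¹ *
        (z * deriv (fun v => (Q k).eval v / (N k ^ m * (P k).eval v)) z)) atTop (𝓝 0) := by
      refine hNlim.zero_mul_isBoundedUnder_le ?_
      refine isBoundedUnder_of ⟨‖z‖ * M₃, fun k => ?_⟩
      rw [Function.comp_apply, norm_mul]
      exact mul_le_mul_of_nonneg_left (h₃.self_of_nhds k) (norm_nonneg _)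
    have hlim := ((hω.add hc).mul hg).add hsmall
    rw [add_zero] at hlim
    exact hlim.congr fun k => (eval_eulerShift_div (hN k) (hP k) (c k) m hz).symm

lemma eulerShiftProd_asymptotics (hU : IsOpen U) (hN : ∀ k, N k ≠ 0)
    (hNlim : Tendsto (fun k => (N k)⁻¹) atTop (𝓝 0)) (hP : ∀ k, ∀ y ∈ U, (P k).eval y ≠ 0)
    (hw : LocallyUnifBounded U fun k y => y * (P k).derivative.eval y / (N k * (P k).eval y))
    {z ω : ℂ} (hz : z ∈ U)
    (hω : Tendsto (fun k => z * (P k).derivative.eval z / (N k * (P k).eval z)) atTop (𝓝 ω))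
    {c : ℕ → ℕ → ℂ} {a : ℕ → ℂ} (hc : ∀ i, Tendsto (fun k => c k i / N k) atTop (𝓝 (a i)))
    (s : ℕ) :
    (LocallyUnifBounded U fun k y =>
        (eulerShiftProd (c k) (P k) s).eval y / (N k ^ s * (P k).eval y)) ∧
      Tendsto (fun k => (eulerShiftProd (c k) (P k) s).eval z / (N k ^ s * (P k).eval z))
        atTop (𝓝 (∏ i ∈ Finset.range s, (ω + a i))) := by
  induction s with
  | zero =>
    constructor
    · intro v hv
      refine ⟨1, ?_⟩
      filter_upwards [hU.mem_nhds hv] with y hy k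
      simp [eulerShiftProd, div_self (hP k y hy)]
    · simp [eulerShiftProd, div_self (hP _ z hz)]
  | succ s ih =>
    rw [Finset.prod_range_succ, mul_comm]
    exact eulerShift_asymptotics hU hN hNlim hP hw hz hω ih.1 ih.2 (hc s)

end EulerAsymptotics

/-- The coefficient of `x ^ k` in `jacAng r n α β x`. -/
noncomputable def jacAngCoeff (r n : ℕ) (α β : ℝ) (k : ℕ) : ℝ :=
  (n.choose k : ℝ) *
    (Real.Gamma (n + α + (β + k) / r + 1) /
      (Real.Gamma (n + α + 1) * Real.Gamma ((β + k) / r + 1))) *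
    (-1) ^ (n - k)

open Polynomial in
/-- `jacAng r n α β` as a polynomial with complex coefficients. -/
noncomputable def jacAngPoly (r n : ℕ) (α β : ℝ) : ℂ[X] :=
  ∑ k ∈ Finset.range (n + 1), C (jacAngCoeff r n α β k : ℂ) * X ^ k

lemma coeff_jacAngPoly (r n : ℕ) (α β : ℝ) (m : ℕ) :
    (jacAngPoly r n α β).coeff m = jacAngCoeff r n α β m := by
  simp only [jacAngPoly, Polynomial.finsetSum_coeff, Polynomial.coeff_C_mul_X_pow,
    Finset.sum_ite_eq, Finset.mem_range]
  split_ifs with h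
  · rfl
  · simp [jacAngCoeff, Nat.choose_eq_zero_of_lt (show n < m by omega)]

lemma eval_jacAngPoly_ofReal (r n : ℕ) (α β x : ℝ) :
    (jacAngPoly r n α β).eval (x : ℂ) = (jacAng r n α β x : ℂ) := by
  simp [jacAngPoly, jacAng, jacAngCoeff, Polynomial.eval_finsetSum]

lemma choose_mul_sign_mul_prod (n k r : ℕ) :
    (n.choose (k + r) : ℝ) * (-1) ^ (n - (k + r)) * ∏ i ∈ Finset.range r, ((k : ℝ) + r - i) =
      (n.choose k : ℝ) * (-1) ^ (n - k) * ∏ i ∈ Finset.range r, ((k : ℝ) - n + i) := by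
  induction r with
  | zero => simp
  | succ r ih =>
    rw [Finset.prod_range_succ', Finset.prod_range_succ, ← mul_assoc _ _ ((k : ℝ) - n + r), ← ih]
    have hprod : ∏ i ∈ Finset.range r, ((k : ℝ) + ((r + 1 : ℕ) : ℝ) - ((i + 1 : ℕ) : ℝ)) =
        ∏ i ∈ Finset.range r, ((k : ℝ) + r - i) :=
      Finset.prod_congr rfl fun i _ => by push_cast; ring
    rw [hprod]
    have hstep : (n.choose (k + r + 1) : ℝ) * (-1) ^ (n - (k + r + 1)) * ((k : ℝ) + r + 1) =
        (n.choose (k + r) : ℝ) * (-1) ^ (n - (k + r)) * ((k : ℝ) - n + r) := by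
      rcases lt_or_ge (k + r) n with h | h
      · have hc : (n.choose (k + r + 1) : ℝ) * ((k : ℝ) + r + 1) =
            n.choose (k + r) * ((n : ℝ) - (k + r)) := by
          have := congrArg (Nat.cast : ℕ → ℝ) (Nat.choose_succ_right_eq n (k + r))
          push_cast [Nat.cast_sub h.le] at this
          exact this
        rw [show n - (k + r) = n - (k + r + 1) + 1 by omega, pow_succ]
        linear_combination (-1 : ℝ) ^ (n - (k + r + 1)) * hc
      · rw [Nat.choose_eq_zero_of_lt (show n < k + r + 1 by omega)]
        rcases h.eq_or_lt with h | h
        · rw [show ((k : ℝ) - n + r) = 0 by rw [h]; push_cast; ring]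
          simp
        · simp [Nat.choose_eq_zero_of_lt h]
    push_cast
    rw [← add_assoc]
    linear_combination (∏ i ∈ Finset.range r, ((k : ℝ) + r - i)) * hstep

lemma div_add_one_pos {r : ℕ} (hr : 1 ≤ r) {β : ℝ} (hβ : -1 < β) (k : ℕ) :
    0 < (β + k) / r + 1 := by
  have hr' : (1 : ℝ) ≤ r := by exact_mod_cast hr
  have hk : (0 : ℝ) ≤ k := k.cast_nonneg
  have hr0 : (0 : ℝ) < r := by linarith
  rw [div_add_one hr0.ne']
  exact div_pos (by linarith) hr0

lemma jacAngCoeff_add {r n : ℕ} (hr : 1 ≤ r) (hn : 1 ≤ n) {α β : ℝ} (hα : -1 < α)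
    (hβ : -1 < β) (k : ℕ) :
    (∏ i ∈ Finset.range r, ((k : ℝ) + r - i)) * ((k : ℝ) + r + β) *
        jacAngCoeff r n α β (k + r) =
      (∏ i ∈ Finset.range r, ((k : ℝ) - n + i)) * ((k : ℝ) + (r * (n + α + 1) + β)) *
        jacAngCoeff r n α β k := by
  have hB := div_add_one_pos hr hβ k
  have hn' : (1 : ℝ) ≤ n := by exact_mod_cast hn
  have hA : 0 < (n : ℝ) + α + (β + k) / r + 1 := by linarith
  have hr0 : (r : ℝ) ≠ 0 := by positivity
  have hshift : (β + ((k + r : ℕ) : ℝ)) / r = (β + k) / r + 1 := by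
    push_cast
    field_simp
    ring
  have hch := choose_mul_sign_mul_prod n k r
  unfold jacAngCoeff
  rw [hshift, Real.Gamma_add_one hB.ne', ← add_assoc ((n : ℝ) + α), Real.Gamma_add_one hA.ne']
  have hΓB := (Real.Gamma_pos_of_pos hB).ne'
  have hΓα := (Real.Gamma_pos_of_pos (show 0 < (n : ℝ) + α + 1 by linarith)).ne'
  have hBr : (k : ℝ) + r + β = r * ((β + k) / r + 1) := by field_simp; ring
  have hAr : (k : ℝ) + (r * (n + α + 1) + β) = r * ((n : ℝ) + α + (β + k) / r + 1) := by
    field_simp; ring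
  rw [hBr, hAr]
  generalize (β + k) / r + 1 = B at *
  generalize (n : ℝ) + α + (β + k) / r + 1 = A at *
  field_simp
  linear_combination hch

/-- The exponents of the differential operator annihilating `jacAngPoly` at the origin. -/
noncomputable def jacAngShiftZero (r : ℕ) (β : ℝ) (i : ℕ) : ℂ :=
  if i < r then -i else β

/-- The exponents of the differential operator annihilating `jacAngPoly` at infinity. -/
noncomputable def jacAngShiftInfty (r n : ℕ) (α β : ℝ) (i : ℕ) : ℂ :=
  if i < r then -n + i else r * (n + α + 1) + β

lemma prod_range_succ_ite {r : ℕ} (f : ℕ → ℂ) (b m : ℂ) :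
    ∏ i ∈ Finset.range (r + 1), (m + if i < r then f i else b) =
      (∏ i ∈ Finset.range r, (m + f i)) * (m + b) := by
  rw [Finset.prod_range_succ, if_neg (lt_irrefl r)]
  congr 1
  exact Finset.prod_congr rfl fun i hi => by rw [if_pos (Finset.mem_range.1 hi)]

open Polynomial in
/-- The hypergeometric differential equation of `jacAngPoly`. -/
lemma jacAngPoly_differential_equation {r n : ℕ} (hr : 1 ≤ r) (hn : 1 ≤ n) {α β : ℝ}
    (hα : -1 < α) (hβ : -1 < β) :
    eulerShiftProd (jacAngShiftZero r β) (jacAngPoly r n α β) (r + 1) =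
      X ^ r * eulerShiftProd (jacAngShiftInfty r n α β) (jacAngPoly r n α β) (r + 1) := by
  ext m
  rw [coeff_eulerShiftProd, coeff_X_pow_mul', coeff_jacAngPoly]
  simp only [jacAngShiftZero]
  rw [prod_range_succ_ite]
  split_ifs with h
  · obtain ⟨k, rfl⟩ := Nat.exists_eq_add_of_le' h
    rw [Nat.add_sub_cancel, coeff_eulerShiftProd, coeff_jacAngPoly]
    simp only [jacAngShiftInfty]
    rw [prod_range_succ_ite]
    have := congrArg (Complex.ofReal) (jacAngCoeff_add hr hn hα hβ k)
    push_cast at this ⊢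
    simp only [← sub_eq_add_neg, ← add_assoc] at this ⊢
    exact this
  · rw [Finset.prod_eq_zero (Finset.mem_range.2 (not_le.1 h)) (by simp)]
    simp

open Polynomial in
/-- `jacAngPoly` is determined by its zeros up to a nonzero factor. -/
lemma jacAngPoly_eq_C_mul_prod {r n : ℕ} (hr : 1 ≤ r) (hn : 1 ≤ n) {α β : ℝ} (hα : -1 < α)
    (hβ : -1 < β) {x : Fin n → ℝ} (hzero : ∀ j, jacAng r n α β (x j) = 0)
    (hinj : Function.Injective x) :
    ∃ a : ℂ, a ≠ 0 ∧ jacAngPoly r n α β = C a * ∏ j, (X - C (x j : ℂ)) := by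
  have hB := div_add_one_pos hr hβ n
  have hn' : (1 : ℝ) ≤ n := by exact_mod_cast hn
  have hlead : (jacAngPoly r n α β).coeff n ≠ 0 := by
    rw [coeff_jacAngPoly, jacAngCoeff]
    have h₁ := Real.Gamma_pos_of_pos hB
    have h₂ := Real.Gamma_pos_of_pos (show 0 < (n : ℝ) + α + 1 by linarith)
    have h₃ := Real.Gamma_pos_of_pos (show 0 < (n : ℝ) + α + (β + n) / r + 1 by linarith)
    simp [h₁.ne', h₂.ne', h₃.ne']
  have hne : jacAngPoly r n α β ≠ 0 := fun h => hlead (by simp [h])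
  have hdeg : (jacAngPoly r n α β).natDegree ≤ n := by
    refine natDegree_le_iff_coeff_eq_zero.2 fun m hm => ?_
    simp [coeff_jacAngPoly, jacAngCoeff, Nat.choose_eq_zero_of_lt hm]
  have hxinj : Function.Injective fun j => (x j : ℂ) := Complex.ofReal_injective.comp hinj
  have hle : Finset.univ.val.map (fun j => (x j : ℂ)) ≤ (jacAngPoly r n α β).roots := by
    refine (Multiset.le_iff_subset (Multiset.Nodup.map hxinj Finset.univ.nodup)).2 fun y hy => ?_
    obtain ⟨j, -, rfl⟩ := Multiset.mem_map.1 hy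
    rw [mem_roots hne, IsRoot.def, eval_jacAngPoly_ofReal, hzero, Complex.ofReal_zero]
  have hcard := card_roots' (jacAngPoly r n α β)
  have heq := Multiset.eq_of_le_of_card_le hle (by simpa using hcard.trans hdeg)
  refine ⟨(jacAngPoly r n α β).leadingCoeff, leadingCoeff_ne_zero.2 hne, ?_⟩
  have hroots : (jacAngPoly r n α β).roots.card = (jacAngPoly r n α β).natDegree := by
    refine le_antisymm hcard (hdeg.trans_eq ?_)
    rw [← heq]
    simp
  have := C_leadingCoeff_mul_prod_multiset_X_sub_C hroots
  rw [← heq, Multiset.map_map] at this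
  exact this.symm

open Polynomial in
lemma eval_derivative_div_C_mul_prod {n : ℕ} {a : ℂ} (ha : a ≠ 0) (x : Fin n → ℂ) {y : ℂ}
    (hy : ∀ j, y ≠ x j) :
    (derivative (C a * ∏ j, (X - C (x j)))).eval y / (C a * ∏ j, (X - C (x j))).eval y =
      ∑ j, 1 / (y - x j) := by
  have hlog := logDeriv_prod (s := Finset.univ) (f := fun j v => v - x j) (x := y)
    (fun j _ => sub_ne_zero.2 (hy j)) (fun j _ => by fun_prop)
  have heval : (fun v => ∏ j, (v - x j)) = fun v => (∏ j, (X - C (x j))).eval v := by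
    ext v
    simp [eval_prod]
  rw [derivative_C_mul, eval_C_mul, eval_C_mul, mul_div_mul_left _ _ ha]
  rw [heval, logDeriv_apply, Polynomial.deriv] at hlog
  rw [hlog]
  exact Finset.sum_congr rfl fun j _ => by simp [logDeriv_apply]

/-- The cut `[0, 1]` as a subset of the complex plane. -/
def unitCut : Set ℂ := Complex.ofReal '' Set.Icc (0 : ℝ) 1

lemma isClosed_unitCut : IsClosed unitCut :=
  (isCompact_Icc.image Complex.continuous_ofReal).isClosed

open MeasureTheory Filter Topology in
/-- Weak convergence of averages over points of `[0, 1]` extends to complex functions that are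
continuous on `[0, 1]` only. -/
lemma tendsto_average_of_continuousOn {n : ℕ → ℕ} {x : (k : ℕ) → Fin (n k) → ℝ}
    (hx : ∀ k j, x k j ∈ Set.Icc (0 : ℝ) 1) {μ : Measure ℝ} [IsProbabilityMeasure μ]
    (hsupp : μ (Set.Icc (0 : ℝ) 1)ᶜ = 0)
    (hweak : ∀ f : ℝ → ℝ, Continuous f →
      Tendsto (fun k => (1 / (n k : ℝ)) * ∑ j, f (x k j)) atTop (𝓝 (∫ t, f t ∂μ)))
    {f : ℝ → ℂ} (hf : ContinuousOn f (Set.Icc 0 1)) :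
    Tendsto (fun k => (1 / (n k : ℂ)) * ∑ j, f (x k j)) atTop (𝓝 (∫ t, f t ∂μ)) := by
  set F : ℝ → ℂ := Set.IccExtend zero_le_one ((Set.Icc (0 : ℝ) 1).domRestrict f) with hF
  have hFc : Continuous F := hf.domRestrict.Icc_extend'
  have hFeq : ∀ t ∈ Set.Icc (0 : ℝ) 1, F t = f t := fun t ht => by
    rw [hF, Set.IccExtend_of_mem _ _ ht, Set.domRestrict_apply]
  have hae : F =ᵐ[μ] f := by
    filter_upwards [mem_ae_iff.2 hsupp] with t ht using hFeq t ht
  obtain ⟨M, hM⟩ := (isCompact_Icc (a := (0 : ℝ)) (b := 1)).exists_bound_of_continuousOn hf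
  have hint : Integrable F μ := by
    refine Integrable.of_bound hFc.aestronglyMeasurable M ?_
    filter_upwards [mem_ae_iff.2 hsupp] with t ht
    rw [hFeq t ht]
    exact hM t ht
  have hre := hweak _ (Complex.continuous_re.comp hFc)
  have him := hweak _ (Complex.continuous_im.comp hFc)
  have hlim := ((Complex.continuous_ofReal.tendsto _).comp hre).add
    (((Complex.continuous_ofReal.tendsto _).comp him).mul_const Complex.I)
  have hval : ((∫ t, (F t).re ∂μ : ℝ) : ℂ) + ((∫ t, (F t).im ∂μ : ℝ) : ℂ) * Complex.I =
      ∫ t, f t ∂μ := by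
    rw [← integral_congr_ae hae]
    exact integral_re_add_im hint
  simp only [Function.comp_def] at hlim
  rw [hval] at hlim
  refine hlim.congr fun k => ?_
  rw [Finset.sum_congr rfl fun j _ => (hFeq _ (hx k j)).symm]
  push_cast
  rw [mul_assoc, ← mul_add, Finset.sum_mul, ← Finset.sum_add_distrib]
  simp only [Complex.re_add_im]

/-- Expansion of `(w + r) (w - 1) ^ r` in powers of `w`. -/
lemma add_mul_sub_one_pow (r : ℕ) (w : ℂ) :
    (w + r) * (w - 1) ^ r = w ^ (r + 1) -
      ∑ ℓ ∈ Finset.range r,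
        ((-1 : ℂ) ^ (r + ℓ + 1) * ((r + 1).choose ℓ : ℂ) * ((r : ℂ) - ℓ)) * w ^ ℓ := by
  have hA : (w - 1) ^ r = ∑ ℓ ∈ Finset.range (r + 1), (-1 : ℂ) ^ (r + ℓ) * r.choose ℓ * w ^ ℓ := by
    rw [sub_eq_add_neg, add_pow]
    refine Finset.sum_congr rfl fun ℓ hℓ => ?_
    have : (-1 : ℂ) ^ (r + ℓ) = (-1) ^ (r - ℓ) := by
      rw [show r + ℓ = (r - ℓ) + 2 * ℓ by have := Finset.mem_range.1 hℓ; omega, pow_add, pow_mul]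
      simp
    rw [this]
    ring
  have hB : (w - 1) ^ (r + 1) =
      ∑ ℓ ∈ Finset.range (r + 2), (-1 : ℂ) ^ (r + ℓ + 1) * (r + 1).choose ℓ * w ^ ℓ := by
    rw [sub_eq_add_neg, add_pow]
    refine Finset.sum_congr rfl fun ℓ hℓ => ?_
    have : (-1 : ℂ) ^ (r + ℓ + 1) = (-1) ^ (r + 1 - ℓ) := by
      rw [show r + ℓ + 1 = (r + 1 - ℓ) + 2 * ℓ by have := Finset.mem_range.1 hℓ; omega,
        pow_add, pow_mul]
      simp
    rw [this]
    ring
  have hsplit : (w + r) * (w - 1) ^ r = (w - 1) ^ (r + 1) + (r + 1) * (w - 1) ^ r := by ring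
  have hone : (-1 : ℂ) ^ (r + r) = 1 := by rw [← two_mul, pow_mul]; simp
  rw [hsplit, hA, hB, Finset.sum_range_succ, Finset.sum_range_succ, Finset.sum_range_succ,
    mul_add, Finset.mul_sum]
  have hcomb : ∑ ℓ ∈ Finset.range r, (-1 : ℂ) ^ (r + ℓ + 1) * (r + 1).choose ℓ * w ^ ℓ +
      ∑ ℓ ∈ Finset.range r, ((r : ℂ) + 1) * ((-1 : ℂ) ^ (r + ℓ) * r.choose ℓ * w ^ ℓ) =
      -∑ ℓ ∈ Finset.range r,
        ((-1 : ℂ) ^ (r + ℓ + 1) * ((r + 1).choose ℓ : ℂ) * ((r : ℂ) - ℓ)) * w ^ ℓ := by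
    rw [← Finset.sum_add_distrib, ← Finset.sum_neg_distrib]
    refine Finset.sum_congr rfl fun ℓ hℓ => ?_
    have hc : ((r + 1 : ℕ) : ℂ) * r.choose ℓ = (r + 1).choose ℓ * ((r : ℂ) + 1 - ℓ) := by
      have := congrArg (Nat.cast : ℕ → ℂ) (Nat.choose_mul_succ_eq r ℓ)
      rw [Nat.cast_mul, Nat.cast_mul,
        Nat.cast_sub (by have := Finset.mem_range.1 hℓ; omega)] at this
      push_cast at this ⊢
      rw [mul_comm, this]
    push_cast at hc
    rw [pow_succ (-1 : ℂ) (r + ℓ)]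
    linear_combination (-1 : ℂ) ^ (r + ℓ) * w ^ ℓ * hc
  rw [Nat.choose_self, Nat.choose_self, Nat.choose_succ_self_right, pow_succ (-1 : ℂ) (r + r),
    show r + (r + 1) + 1 = r + r + 2 by ring, pow_add (-1 : ℂ) (r + r) 2, hone]
  push_cast
  linear_combination hcomb

/-- if the normalized zero counting measures μ_{n_k} of p_{n_k}(x; α, β) converge
weakly to a probability measure μ on [0,1], then the Stieltjes transform
S(z) = ∫ dμ(x)/(z−x) satisfies, for z ∈ ℂ ∖ [0,1],
z(1−z^r) S^{r+1} + ∑_{ℓ=0}^{r−1} (−1)^{r+ℓ+1} C(r+1,ℓ)(r−ℓ) z^ℓ S^ℓ = 0, equivalently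
z S^{r+1} = (zS+r)(zS−1)^r. -/
theorem jacAng_stieltjes_transform_algebraic_equation
    (r : ℕ) (hr : 1 ≤ r) (α β : ℝ) (hα : -1 < α) (hβ : -1 < β)
    (x : (n : ℕ) → Fin n → ℝ)
    (hmem : ∀ n, ∀ j : Fin n, x n j ∈ Set.Ioo (0:ℝ) 1)
    (hzero : ∀ n, ∀ j : Fin n, jacAng r n α β (x n j) = 0)
    (hinj : ∀ n, Function.Injective (x n))
    (nk : ℕ → ℕ) (hnk : StrictMono nk) (hpos : ∀ k, 1 ≤ nk k)
    (μ : MeasureTheory.Measure ℝ) [MeasureTheory.IsProbabilityMeasure μ]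
    (hsupp : μ (Set.Icc (0:ℝ) 1)ᶜ = 0)
    (hweak : ∀ f : ℝ → ℝ, Continuous f →
      Filter.Tendsto (fun k : ℕ => (1 / (nk k : ℝ)) * ∑ j : Fin (nk k), f (x (nk k) j))
        Filter.atTop (nhds (∫ t, f t ∂μ)))
    (z : ℂ) (hz : ¬(z.im = 0 ∧ z.re ∈ Set.Icc (0:ℝ) 1)) :
    let S : ℂ := ∫ t, 1 / (z - (t : ℂ)) ∂μ
    z * (1 - z ^ r) * S ^ (r + 1) +
        (∑ ℓ ∈ Finset.range r,
          ((-1 : ℂ) ^ (r + ℓ + 1) * ((r + 1).choose ℓ : ℂ) * ((r : ℂ) - ℓ)) * z ^ ℓ * S ^ ℓ) = 0 ∧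
      z * S ^ (r + 1) = (z * S + r) * (z * S - 1) ^ r := by
  intro S
  have hzU : z ∈ unitCutᶜ := by
    rintro ⟨t, ht, rfl⟩
    exact hz ⟨Complex.ofReal_im t, by simpa using ht⟩
  have hU : IsOpen unitCutᶜ := isClosed_unitCut.isOpen_compl
  have hz0 : z ≠ 0 := by
    rintro rfl
    exact hzU ⟨0, by simp, by simp⟩
  have hcut : ∀ n (j : Fin n), (x n j : ℂ) ∈ unitCut := fun n j =>
    ⟨x n j, Set.Ioo_subset_Icc_self (hmem n j), rfl⟩
  have hsep : ∀ y ∈ unitCutᶜ, ∀ n (j : Fin n), y ≠ x n j := by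
    rintro y hy n j rfl
    exact hy (hcut n j)
  have hN : ∀ k, ((nk k : ℕ) : ℂ) ≠ 0 := fun k =>
    Nat.cast_ne_zero.2 (Nat.one_le_iff_ne_zero.1 (hpos k))
  have hNlim : Filter.Tendsto (fun k => ((nk k : ℕ) : ℂ)⁻¹) Filter.atTop (nhds 0) :=
    (tendsto_inv_atTop_nhds_zero_nat (𝕜 := ℂ)).comp hnk.tendsto_atTop
  choose a ha hfac using fun k =>
    jacAngPoly_eq_C_mul_prod hr (hpos k) hα hβ (hzero (nk k)) (hinj (nk k))
  have hP : ∀ k, ∀ y ∈ unitCutᶜ, (jacAngPoly r (nk k) α β).eval y ≠ 0 := by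
    intro k y hy
    rw [hfac, Polynomial.eval_C_mul, Polynomial.eval_prod]
    refine mul_ne_zero (ha k) (Finset.prod_ne_zero_iff.2 fun j _ => ?_)
    simpa using sub_ne_zero.2 (hsep y hy _ j)
  have hlog : ∀ k, ∀ y ∈ unitCutᶜ,
      y * (jacAngPoly r (nk k) α β).derivative.eval y /
          ((nk k : ℂ) * (jacAngPoly r (nk k) α β).eval y) =
        y * ((1 / (nk k : ℂ)) * ∑ j, 1 / (y - (x (nk k) j : ℂ))) := by
    intro k y hy
    rw [← eval_derivative_div_C_mul_prod (ha k) (fun j => (x (nk k) j : ℂ)) (hsep y hy _),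
      ← hfac]
    ring
  have hw : LocallyUnifBounded unitCutᶜ fun k y =>
      y * (jacAngPoly r (nk k) α β).derivative.eval y /
        ((nk k : ℂ) * (jacAngPoly r (nk k) α β).eval y) := by
    intro v hv
    obtain ⟨ε, hε, hball⟩ := Metric.isOpen_iff.1 hU v hv
    refine ⟨(‖v‖ + ε) * (1 / (ε / 2)), ?_⟩
    filter_upwards [Metric.ball_mem_nhds v (half_pos hε)] with y hy k
    rw [Metric.mem_ball] at hy
    have hyU : y ∈ unitCutᶜ := hball (by rw [Metric.mem_ball]; linarith)
    rw [hlog k y hyU, norm_mul]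
    have hyn : ‖y‖ ≤ ‖v‖ + ε := by
      rw [dist_eq_norm] at hy
      linarith [norm_sub_norm_le y v]
    refine mul_le_mul hyn ?_ (norm_nonneg _) (by positivity)
    have hterm : ∀ j, ‖1 / (y - (x (nk k) j : ℂ))‖ ≤ 1 / (ε / 2) := by
      intro j
      rw [norm_div, norm_one, ← dist_eq_norm]
      refine one_div_le_one_div_of_le (by positivity) ?_
      by_contra! hlt
      refine hball (a := (x (nk k) j : ℂ)) ?_ (hcut _ j)
      rw [Metric.mem_ball]
      linarith [dist_triangle_left (x (nk k) j : ℂ) v y]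
    have hsum := norm_sum_le_of_le Finset.univ fun j _ => hterm j
    rw [Finset.sum_const, Finset.card_univ, Fintype.card_fin, nsmul_eq_mul] at hsum
    have hnpos : (0 : ℝ) < nk k := by exact_mod_cast hpos k
    rw [norm_mul, norm_div, norm_one, Complex.norm_natCast, one_div_mul_eq_div,
      div_le_iff₀' hnpos]
    exact hsum
  have hω : Filter.Tendsto (fun k => z * (jacAngPoly r (nk k) α β).derivative.eval z /
      ((nk k : ℂ) * (jacAngPoly r (nk k) α β).eval z)) Filter.atTop (nhds (z * S)) := by
    have hcont : ContinuousOn (fun t : ℝ => 1 / (z - (t : ℂ))) (Set.Icc 0 1) := by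
      refine continuousOn_const.div (by fun_prop) fun t ht => sub_ne_zero.2 ?_
      rintro rfl
      exact hzU ⟨t, ht, rfl⟩
    have hS := tendsto_average_of_continuousOn
      (fun k j => Set.Ioo_subset_Icc_self (hmem (nk k) j)) hsupp hweak hcont
    exact (hS.const_mul z).congr fun k => (hlog k z hzU).symm
  have hconst : ∀ b : ℂ, Filter.Tendsto (fun k => b / (nk k : ℂ)) Filter.atTop (nhds 0) := by
    intro b
    simpa [div_eq_mul_inv] using hNlim.const_mul b
  have hzeroLim := (eulerShiftProd_asymptotics hU hN hNlim hP hw hzU hω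
    (c := fun _ => jacAngShiftZero r β) (a := fun _ => 0) (fun i => hconst _) (r + 1)).2
  have hinftyLim := (eulerShiftProd_asymptotics hU hN hNlim hP hw hzU hω
    (c := fun k => jacAngShiftInfty r (nk k) α β) (a := fun i => if i < r then -1 else r)
    (fun i => by
      simp only [jacAngShiftInfty]
      split_ifs
      · have := (hconst i).const_add (-1)
        rw [add_zero] at this
        refine this.congr fun k => ?_
        have := hN k
        field_simp
      · have := (hconst (r * (α + 1) + β)).const_add (r : ℂ)
        rw [add_zero] at this
        refine this.congr fun k => ?_
        have := hN k
        field_simp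
        ring) (r + 1)).2
  rw [prod_range_succ_ite] at hinftyLim
  have hlimit := tendsto_nhds_unique hzeroLim ((hinftyLim.const_mul (z ^ r)).congr fun k => by
    rw [jacAngPoly_differential_equation hr (hpos k) hα hβ, Polynomial.eval_mul,
      Polynomial.eval_pow, Polynomial.eval_X, mul_div_assoc])
  simp only [add_zero, Finset.prod_const, Finset.card_range] at hlimit
  have hmain : z * S ^ (r + 1) = (z * S + r) * (z * S - 1) ^ r := by
    refine mul_left_cancel₀ (pow_ne_zero r hz0) ?_
    linear_combination hlimit
  refine ⟨?_, hmain⟩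
  have hexp := add_mul_sub_one_pow r (z * S)
  simp only [mul_pow z S, ← mul_assoc] at hexp ⊢
  linear_combination hmain + hexp
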